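/- arXiv:1303.4358 — 4 statements merged into one kernel-verified Lean document; each statement's English description precedes it below -/
import Mathlib

section
/- For every ε>0 and every η₀∈ℝ² with 0<|η₀|≤ε, the principal value p.v.∫_{ℝ²} α_{ε,η₀}(η)·η/|η|³ dη exists and equals (e^{−r̄₀²}/ε³)·M₃(r̄₀)·η₀, where r̄₀ = |η₀|/ε. -/
open MeasureTheory

/-- `α_{ε,η₀}(η) = ε⁻² exp(-|η-η₀|²/ε²)`. -/
noncomputable def alphaFn (ε : ℝ) (η₀ η : EuclideanSpace ℝ (Fin 2)) : ℝ :=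
  ε⁻¹ ^ 2 * Real.exp (-‖η - η₀‖ ^ 2 / ε ^ 2)

/-- `M₃(z) = z⁻¹ ∫₀^∞ r⁻¹ e^{-r²} (∫₀^{2π} e^{2rz cos θ} cos θ dθ) dr` (real argument). -/
noncomputable def M3R (z : ℝ) : ℝ :=
  z⁻¹ * ∫ r in Set.Ioi (0 : ℝ),
    r⁻¹ * Real.exp (-r ^ 2) *
      ∫ θ in (0 : ℝ)..(2 * Real.pi), Real.exp (2 * r * z * Real.cos θ) * Real.cos θ

/-- The angular integral appearing in `M3R`. -/
noncomputable def angularIntegral (z r : ℝ) : ℝ :=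
  ∫ θ in (0 : ℝ)..(2 * Real.pi), Real.exp (2 * r * z * Real.cos θ) * Real.cos θ

lemma continuous_angularIntegral (z : ℝ) : Continuous (angularIntegral z) := by
  unfold angularIntegral
  exact intervalIntegral.continuous_parametric_intervalIntegral_of_continuous'
    (by fun_prop) _ _

lemma abs_exp_sub_one_le_mul_exp_abs (x : ℝ) : |Real.exp x - 1| ≤ |x| * Real.exp |x| := by
  have h1 := Real.add_one_le_exp x
  have h2 := Real.add_one_le_exp (-x)
  have h3 : Real.exp x * Real.exp (-x) = 1 := by rw [← Real.exp_add]; simp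
  have hp := Real.exp_pos x
  rcases le_total 0 x with hx | hx
  · rw [abs_of_nonneg hx, abs_of_nonneg (by linarith)]
    nlinarith
  · rw [abs_of_nonpos hx, abs_of_nonpos (by linarith [Real.exp_le_one_iff.2 hx])]
    have : 1 ≤ Real.exp (-x) := Real.one_le_exp (by linarith)
    nlinarith

lemma abs_angularIntegral_le {z r : ℝ} (hr : 0 < r) :
    |angularIntegral z r| ≤ 2 * r * |z| * Real.exp (2 * r * |z|) * (2 * Real.pi) := by
  have hcos : ∫ θ in (0 : ℝ)..(2 * Real.pi), Real.cos θ = 0 := by simp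
  have heq : angularIntegral z r =
      ∫ θ in (0 : ℝ)..(2 * Real.pi),
        (Real.exp (2 * r * z * Real.cos θ) - 1) * Real.cos θ := by
    simp_rw [sub_mul, one_mul]
    rw [intervalIntegral.integral_sub, hcos, sub_zero, angularIntegral]
    · exact Continuous.intervalIntegrable (by fun_prop) _ _
    · exact Continuous.intervalIntegrable (by fun_prop) _ _
  rw [heq, ← Real.norm_eq_abs]
  refine (intervalIntegral.norm_integral_le_of_norm_le_const
    (C := 2 * r * |z| * Real.exp (2 * r * |z|)) fun θ _ => ?_).trans ?_
  · rw [Real.norm_eq_abs, abs_mul]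
    have hc := Real.abs_cos_le_one θ
    have hx : |2 * r * z * Real.cos θ| ≤ 2 * r * |z| := by
      rw [abs_mul, abs_mul, abs_of_pos (by positivity : 0 < 2 * r)]
      exact mul_le_of_le_one_right (by positivity) hc
    calc _ ≤ |Real.exp (2 * r * z * Real.cos θ) - 1| * 1 := by gcongr
      _ ≤ |2 * r * z * Real.cos θ| * Real.exp |2 * r * z * Real.cos θ| := by
        rw [mul_one]; exact abs_exp_sub_one_le_mul_exp_abs _
      _ ≤ _ := by gcongr
  · rw [sub_zero, abs_of_pos Real.two_pi_pos]

lemma integrableOn_inv_mul_exp_mul_angularIntegral (z : ℝ) :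
    IntegrableOn (fun r : ℝ => r⁻¹ * Real.exp (-r ^ 2) * angularIntegral z r) (Set.Ioi 0) := by
  have hI : IntegrableOn (fun r : ℝ => 2 * |z| * (2 * Real.pi) * Real.exp (2 * z ^ 2) *
      Real.exp (-(1 / 2) * r ^ 2)) (Set.Ioi 0) :=
    ((integrable_exp_neg_mul_sq (by norm_num)).const_mul _).integrableOn
  refine hI.mono' ?_ ?_
  · have := (continuous_angularIntegral z).measurable
    exact Measurable.aestronglyMeasurable (by fun_prop)
  · filter_upwards [ae_restrict_mem measurableSet_Ioi] with r (hr : 0 < r)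
    rw [Real.norm_eq_abs, abs_mul, abs_mul, abs_of_pos (inv_pos.2 hr), Real.abs_exp]
    calc _ ≤ r⁻¹ * Real.exp (-r ^ 2) *
          (2 * r * |z| * Real.exp (2 * r * |z|) * (2 * Real.pi)) := by
          gcongr; exact abs_angularIntegral_le hr
      _ = 2 * |z| * (2 * Real.pi) * Real.exp (-r ^ 2 + 2 * r * |z|) := by
          rw [Real.exp_add]; field_simp
      _ ≤ 2 * |z| * (2 * Real.pi) * Real.exp (2 * z ^ 2 + -(1 / 2) * r ^ 2) := by
          refine mul_le_mul_of_nonneg_left (Real.exp_le_exp.2 ?_) (by positivity)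
          nlinarith [sq_nonneg (r - 2 * |z|), sq_abs z]
      _ = _ := by rw [Real.exp_add]; ring

lemma tendsto_integral_Ioi_angularIntegral (z : ℝ) :
    Filter.Tendsto
      (fun t : ℝ => ∫ r in Set.Ioi t, r⁻¹ * Real.exp (-r ^ 2) * angularIntegral z r)
      (nhdsWithin 0 (Set.Ioi 0))
      (nhds (∫ r in Set.Ioi (0 : ℝ), r⁻¹ * Real.exp (-r ^ 2) * angularIntegral z r)) := by
  have h : Filter.Tendsto (fun t : ℝ => t) (nhdsWithin 0 (Set.Ioi 0)) (nhds 0) :=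
    tendsto_nhdsWithin_of_tendsto_nhds Filter.tendsto_id
  refine ((aecover_Ioi_of_Ioi (μ := volume) h).integral_tendsto_of_countably_generated
    (integrableOn_inv_mul_exp_mul_angularIntegral z)).congr' ?_
  filter_upwards [self_mem_nhdsWithin] with t (ht : 0 < t)
  rw [Measure.restrict_restrict measurableSet_Ioi,
    Set.inter_eq_left.2 (Set.Ioi_subset_Ioi ht.le)]

lemma integral_Ioo_exp_cos_mul_cos_add_sin_I (z r : ℝ) :
    ∫ θ in Set.Ioo (-Real.pi) Real.pi, (Real.exp (2 * r * z * Real.cos θ) : ℂ) *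
      (Real.cos θ + Real.sin θ * Complex.I) = angularIntegral z r := by
  rw [← integral_Ioc_eq_integral_Ioo,
    ← intervalIntegral.integral_of_le (by linarith [Real.pi_pos])]
  have hcos : ∫ θ in (-Real.pi)..Real.pi, Real.exp (2 * r * z * Real.cos θ) * Real.cos θ =
      angularIntegral z r := by
    have hp : Function.Periodic
        (fun θ => Real.exp (2 * r * z * Real.cos θ) * Real.cos θ) (2 * Real.pi) := fun θ => by
      simp only [Real.cos_add_two_pi]
    have := hp.intervalIntegral_add_eq (-Real.pi) 0
    rw [zero_add, show -Real.pi + 2 * Real.pi = Real.pi by ring] at this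
    exact this
  have hsin : ∫ θ in (-Real.pi)..Real.pi, Real.exp (2 * r * z * Real.cos θ) * Real.sin θ = 0 := by
    have := intervalIntegral.integral_comp_neg (a := -Real.pi) (b := Real.pi)
      (fun θ => Real.exp (2 * r * z * Real.cos θ) * Real.sin θ)
    simp only [Real.cos_neg, Real.sin_neg, mul_neg, intervalIntegral.integral_neg, neg_neg] at this
    linarith
  calc _ = ∫ θ in (-Real.pi)..Real.pi,
        (((Real.exp (2 * r * z * Real.cos θ) * Real.cos θ : ℝ) : ℂ) +
        ((Real.exp (2 * r * z * Real.cos θ) * Real.sin θ : ℝ) : ℂ) * Complex.I) := by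
        congr 1; ext θ; push_cast; ring
    _ = _ := by
      rw [intervalIntegral.integral_add, intervalIntegral.integral_mul_const,
        intervalIntegral.integral_ofReal, intervalIntegral.integral_ofReal, hcos, hsin]
      · simp
      · exact Continuous.intervalIntegrable (by fun_prop) _ _
      · exact Continuous.intervalIntegrable (by fun_prop) _ _

lemma setIntegral_norm_gt_eq_polar {E : Type*} [NormedAddCommGroup E] [NormedSpace ℝ E]
    (f : ℂ → E) {t : ℝ} (ht : 0 < t) :
    ∫ z in {z : ℂ | t < ‖z‖}, f z =
      ∫ p in Set.Ioi t ×ˢ Set.Ioo (-Real.pi) Real.pi, p.1 • f (Complex.polarCoord.symm p) := by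
  have hm : MeasurableSet {z : ℂ | t < ‖z‖} := measurableSet_lt measurable_const measurable_norm
  have hT : MeasurableSet polarCoord.target := polarCoord.open_target.measurableSet
  have hS : MeasurableSet (Set.Ioi t ×ˢ Set.Ioo (-Real.pi) Real.pi) :=
    measurableSet_Ioi.prod measurableSet_Ioo
  rw [← integral_indicator hm, ← Complex.integral_comp_polarCoord_symm,
    ← integral_indicator hT, ← integral_indicator hS]
  congr 1
  ext p
  simp only [Set.indicator, polarCoord_target, Set.mem_prod, Set.mem_Ioi, Set.mem_ofPred_eq,
    Complex.norm_polarCoord_symm]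
  by_cases h0 : 0 < p.1
  · simp only [abs_of_pos h0]
    split_ifs <;> first | rfl | (exfalso; tauto) | simp
  · have : ¬ t < p.1 := fun h => h0 (ht.trans h)
    simp [h0, this]

lemma normSq_polarCoord_symm_sub_ofReal (p : ℝ × ℝ) (ρ : ℝ) :
    ‖Complex.polarCoord.symm p - (ρ : ℂ)‖ ^ 2 =
      p.1 ^ 2 - 2 * p.1 * ρ * Real.cos p.2 + ρ ^ 2 := by
  rw [← Complex.normSq_eq_norm_sq, Complex.normSq_apply, Complex.polarCoord_symm_apply]
  simp only [Complex.sub_re, Complex.sub_im, Complex.mul_re, Complex.mul_im, Complex.add_re,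
    Complex.add_im, Complex.ofReal_re, Complex.ofReal_im, Complex.I_re, Complex.I_im]
  nlinarith [Real.sin_sq_add_cos_sq p.2]

lemma integrableOn_polar_kernel {ε t : ℝ} (hε : 0 < ε) (ht : 0 < t) (ρ : ℝ) :
    IntegrableOn (fun p : ℝ × ℝ => ((p.1⁻¹ * Real.exp (-(p.1 / ε) ^ 2) : ℝ) : ℂ) *
      ((Real.exp (2 * (p.1 / ε) * (ρ / ε) * Real.cos p.2) : ℂ) *
        (Real.cos p.2 + Real.sin p.2 * Complex.I)))
      (Set.Ioi t ×ˢ Set.Ioo (-Real.pi) Real.pi) := by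
  have hb : 0 < 1 / (2 * ε ^ 2) := by positivity
  have hI : IntegrableOn (fun p : ℝ × ℝ => (t⁻¹ * Real.exp (2 * (ρ / ε) ^ 2) *
      Real.exp (-(1 / (2 * ε ^ 2)) * p.1 ^ 2)) * (2 : ℝ))
      (Set.Ioi t ×ˢ Set.Ioo (-Real.pi) Real.pi) := by
    rw [IntegrableOn, Measure.volume_eq_prod, ← Measure.prod_restrict]
    refine Integrable.mul_prod (f := fun r => t⁻¹ * Real.exp (2 * (ρ / ε) ^ 2) *
      Real.exp (-(1 / (2 * ε ^ 2)) * r ^ 2)) (g := fun _ => (2 : ℝ)) ?_ (by simp)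
    exact ((integrable_exp_neg_mul_sq hb).const_mul _).integrableOn
  refine hI.mono' (Measurable.aestronglyMeasurable (by fun_prop)) ?_
  filter_upwards [ae_restrict_mem (measurableSet_Ioi.prod measurableSet_Ioo)] with p hp
  have hr : t < p.1 := hp.1
  have hr0 : 0 < p.1 := ht.trans hr
  rw [norm_mul, norm_mul, Complex.norm_real, Complex.norm_real, Real.norm_eq_abs,
    Real.norm_eq_abs, Real.abs_exp, abs_of_pos (by positivity)]
  have hu : ‖(Real.cos p.2 + Real.sin p.2 * Complex.I : ℂ)‖ ≤ 2 := by
    refine (norm_add_le _ _).trans ?_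
    rw [norm_mul, Complex.norm_I, mul_one, Complex.norm_real, Complex.norm_real,
      Real.norm_eq_abs, Real.norm_eq_abs]
    linarith [Real.abs_cos_le_one p.2, Real.abs_sin_le_one p.2]
  rw [← mul_assoc]
  refine mul_le_mul ?_ hu (norm_nonneg _) (by positivity)
  rw [mul_assoc, mul_assoc t⁻¹, ← Real.exp_add, ← Real.exp_add]
  refine mul_le_mul (inv_anti₀ ht hr.le) (Real.exp_le_exp.2 ?_) (by positivity) (by positivity)
  have h1 : -(1 / (2 * ε ^ 2)) * p.1 ^ 2 = -(1 / 2) * (p.1 / ε) ^ 2 := by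
    field_simp
  rw [h1]
  nlinarith [sq_nonneg (p.1 / ε - 2 * (ρ / ε) * Real.cos p.2), Real.cos_sq_le_one p.2,
    mul_le_mul_of_nonneg_left (Real.cos_sq_le_one p.2) (sq_nonneg (ρ / ε))]

lemma setIntegral_gaussian_kernel_complex {ε t : ℝ} (hε : 0 < ε) (ht : 0 < t) (ρ : ℝ) :
    ∫ z in {z : ℂ | t < ‖z‖},
        (ε⁻¹ ^ 2 * Real.exp (-‖z - ρ‖ ^ 2 / ε ^ 2) / ‖z‖ ^ 3 : ℝ) • z =
      ((ε⁻¹ ^ 2 * Real.exp (-(ρ / ε) ^ 2) * ∫ s in Set.Ioi (ε⁻¹ * t),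
        s⁻¹ * Real.exp (-s ^ 2) * angularIntegral (ρ / ε) s : ℝ) : ℂ) := by
  rw [setIntegral_norm_gt_eq_polar _ ht]
  have hS : MeasurableSet (Set.Ioi t ×ˢ Set.Ioo (-Real.pi) Real.pi) :=
    measurableSet_Ioi.prod measurableSet_Ioo
  have hpt : ∀ p ∈ Set.Ioi t ×ˢ Set.Ioo (-Real.pi) Real.pi,
      p.1 • ((ε⁻¹ ^ 2 * Real.exp (-‖Complex.polarCoord.symm p - ρ‖ ^ 2 / ε ^ 2) /
        ‖Complex.polarCoord.symm p‖ ^ 3 : ℝ) • Complex.polarCoord.symm p) =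
      ((ε⁻¹ ^ 2 * Real.exp (-(ρ / ε) ^ 2) : ℝ) : ℂ) *
      (((p.1⁻¹ * Real.exp (-(p.1 / ε) ^ 2) : ℝ) : ℂ) *
      ((Real.exp (2 * (p.1 / ε) * (ρ / ε) * Real.cos p.2) : ℂ) *
        (Real.cos p.2 + Real.sin p.2 * Complex.I))) := by
    intro p hp
    have hr0 : 0 < p.1 := ht.trans hp.1
    have hexp : Real.exp (-(p.1 ^ 2 - 2 * p.1 * ρ * Real.cos p.2 + ρ ^ 2) / ε ^ 2) =
        Real.exp (-(ρ / ε) ^ 2) * Real.exp (-(p.1 / ε) ^ 2) *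
          Real.exp (2 * (p.1 / ε) * (ρ / ε) * Real.cos p.2) := by
      rw [← Real.exp_add, ← Real.exp_add]
      congr 1
      field_simp
      ring
    rw [normSq_polarCoord_symm_sub_ofReal, Complex.norm_polarCoord_symm, abs_of_pos hr0, hexp,
      Complex.polarCoord_symm_apply, Complex.real_smul, Complex.real_smul]
    have : (p.1 : ℂ) ≠ 0 := by exact_mod_cast hr0.ne'
    push_cast
    field_simp
  rw [setIntegral_congr_fun hS hpt, integral_const_mul, Measure.volume_eq_prod,
    setIntegral_prod _ (integrableOn_polar_kernel hε ht ρ)]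
  simp_rw [integral_const_mul, integral_Ioo_exp_cos_mul_cos_add_sin_I, ← Complex.ofReal_mul]
  rw [integral_complex_ofReal, ← Complex.ofReal_mul]
  congr 2
  have hsub := integral_comp_mul_left_Ioi
    (fun s => s⁻¹ * Real.exp (-s ^ 2) * angularIntegral (ρ / ε) s) t (inv_pos.2 hε)
  rw [inv_inv, smul_eq_mul] at hsub
  rw [← mul_right_inj' hε.ne', ← hsub, ← integral_const_mul]
  congr 1
  ext r
  rw [← div_eq_inv_mul r ε, inv_div, div_eq_mul_inv ε r]
  ring

lemma exists_linearIsometryEquiv_complex_map_norm {v : EuclideanSpace ℝ (Fin 2)} (hv : v ≠ 0) :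
    ∃ L : ℂ ≃ₗᵢ[ℝ] EuclideanSpace ℝ (Fin 2), L (‖v‖ : ℂ) = v := by
  let L₀ := Complex.isometryOfOrthonormal (EuclideanSpace.basisFun (Fin 2) ℝ)
  have hn : ‖v‖ ≠ 0 := norm_ne_zero_iff.2 hv
  have hw : (‖v‖ : ℂ)⁻¹ * L₀.symm v ∈ Submonoid.unitSphere ℂ := by
    rw [← SetLike.mem_coe, Submonoid.coe_unitSphere, mem_sphere_zero_iff_norm, norm_mul,
      norm_inv, Complex.norm_real, norm_norm, LinearIsometryEquiv.norm_map, inv_mul_cancel₀ hn]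
  let c : Circle := ⟨_, hw⟩
  refine ⟨(rotation c).trans L₀, ?_⟩
  have hn' : (‖v‖ : ℂ) ≠ 0 := by exact_mod_cast hn
  rw [LinearIsometryEquiv.trans_apply, rotation_apply]
  change L₀ ((‖v‖ : ℂ)⁻¹ * L₀.symm v * ‖v‖) = v
  rw [mul_right_comm, inv_mul_cancel₀ hn', one_mul, LinearIsometryEquiv.apply_symm_apply]

/-- For every `ε > 0` and `η₀ ∈ ℝ²` with `0 < |η₀| ≤ ε`, the principal value
`p.v. ∫_{ℝ²} α_{ε,η₀}(η) η / |η|³ dη` exists and equals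
`(e^{-r̄₀²}/ε³) M₃(r̄₀) η₀`, where `r̄₀ = |η₀|/ε`. -/
theorem stmt1 (ε : ℝ) (hε : 0 < ε) (η₀ : EuclideanSpace ℝ (Fin 2))
    (h0 : 0 < ‖η₀‖) (h1 : ‖η₀‖ ≤ ε) :
    Filter.Tendsto
      (fun t : ℝ =>
        ∫ η in {η : EuclideanSpace ℝ (Fin 2) | t < ‖η‖},
          (alphaFn ε η₀ η / ‖η‖ ^ 3) • η)
      (nhdsWithin 0 (Set.Ioi 0))
      (nhds ((Real.exp (-(‖η₀‖ / ε) ^ 2) / ε ^ 3 * M3R (‖η₀‖ / ε)) • η₀)) := by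
  have hv : η₀ ≠ 0 := norm_pos_iff.1 h0
  obtain ⟨L, hL⟩ := exists_linearIsometryEquiv_complex_map_norm hv
  have key : ∀ t : ℝ, 0 < t →
      ∫ η in {η : EuclideanSpace ℝ (Fin 2) | t < ‖η‖}, (alphaFn ε η₀ η / ‖η‖ ^ 3) • η =
        ((Real.exp (-(‖η₀‖ / ε) ^ 2) / ε ^ 3 * ((‖η₀‖ / ε)⁻¹ * ∫ s in Set.Ioi (ε⁻¹ * t),
          s⁻¹ * Real.exp (-s ^ 2) * angularIntegral (‖η₀‖ / ε) s)) • η₀) := by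
    intro t ht
    rw [← L.measurePreserving.setIntegral_preimage_emb L.toHomeomorph.measurableEmbedding]
    have hset : L ⁻¹' {η : EuclideanSpace ℝ (Fin 2) | t < ‖η‖} = {z : ℂ | t < ‖z‖} := by
      ext z; simp
    have hpt : ∀ z : ℂ, (alphaFn ε η₀ (L z) / ‖L z‖ ^ 3) • L z =
        L.toContinuousLinearEquiv
          ((ε⁻¹ ^ 2 * Real.exp (-‖z - (‖η₀‖ : ℂ)‖ ^ 2 / ε ^ 2) / ‖z‖ ^ 3 : ℝ) • z) := by
      intro z
      have : ‖L z - η₀‖ = ‖z - (‖η₀‖ : ℂ)‖ := by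
        rw [← L.norm_map (z - _), map_sub, hL]
      rw [alphaFn, this, L.norm_map, map_smul, LinearIsometryEquiv.coe_toContinuousLinearEquiv]
    simp_rw [hset, hpt]
    rw [ContinuousLinearEquiv.integral_comp_comm, setIntegral_gaussian_kernel_complex hε ht]
    set J := ∫ s in Set.Ioi (ε⁻¹ * t),
      s⁻¹ * Real.exp (-s ^ 2) * angularIntegral (‖η₀‖ / ε) s
    conv_rhs => rw [← hL]
    rw [← map_smul, LinearIsometryEquiv.coe_toContinuousLinearEquiv, Complex.real_smul,
      ← Complex.ofReal_mul]
    congr 2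
    rw [hL]
    field_simp
  have hlim : Filter.Tendsto (fun t : ℝ => ε⁻¹ * t) (nhdsWithin 0 (Set.Ioi 0))
      (nhdsWithin 0 (Set.Ioi 0)) := by
    refine tendsto_nhdsWithin_iff.2 ⟨tendsto_nhdsWithin_of_tendsto_nhds ?_, ?_⟩
    · exact Continuous.tendsto' (by fun_prop) _ _ (by simp)
    · filter_upwards [self_mem_nhdsWithin] with t (ht : 0 < t)
      exact mul_pos (inv_pos.2 hε) ht
  refine Filter.Tendsto.congr' ?_ (((((tendsto_integral_Ioi_angularIntegral (‖η₀‖ / ε)).comp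
    hlim).const_mul (‖η₀‖ / ε)⁻¹).const_mul
      (Real.exp (-(‖η₀‖ / ε) ^ 2) / ε ^ 3)).smul_const η₀)
  filter_upwards [self_mem_nhdsWithin] with t ht
  exact (key t ht).symm
end

section
/- For every z∈ℂ one has ∫₀^∞ r^{-1} e^{-r²} (∫₀^{2π} e^{2rz cos θ} cos θ dθ) dr = π·Σ_{p=0}^∞ Γ(p+1/2)/(p!·(p+1)!) · z^{2p+1}, the power series on the right having infinite radius of convergence; consequently, for z≠0, M₃(z) = π·Σ_{p=0}^∞ Γ(p+1/2)/(p!·(p+1)!)·z^{2p}, so M₃ extends to an entire function. -/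
open MeasureTheory

/-- The integral `∫₀^∞ r⁻¹ e^{-r²} (∫₀^{2π} e^{2rz cos θ} cos θ dθ) dr`. -/
noncomputable def M3int (z : ℂ) : ℂ :=
  ∫ r in Set.Ioi (0 : ℝ),
    (r : ℂ)⁻¹ * Complex.exp (-(r : ℂ) ^ 2) *
      ∫ θ in (0 : ℝ)..(2 * Real.pi),
        Complex.exp (2 * (r : ℂ) * z * (Real.cos θ : ℂ)) * (Real.cos θ : ℂ)

/-- `M₃(z) = z⁻¹ ∫₀^∞ r⁻¹ e^{-r²} (∫₀^{2π} e^{2rz cos θ} cos θ dθ) dr`, for `z ≠ 0`. -/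
noncomputable def M3 (z : ℂ) : ℂ := z⁻¹ * M3int z

/-- The coefficient `Γ(p+1/2)/(p!(p+1)!)`. -/
noncomputable def gammaCoeff (p : ℕ) : ℝ :=
  Real.Gamma ((p : ℝ) + 1 / 2) / ((Nat.factorial p : ℝ) * (Nat.factorial (p + 1) : ℝ))

theorem Gamma_nat_add_half_pos (p : ℕ) : 0 < Real.Gamma ((p : ℝ) + 1 / 2) :=
  Real.Gamma_pos_of_pos (by positivity)

theorem Gamma_nat_add_half_le (p : ℕ) :
    Real.Gamma ((p : ℝ) + 1 / 2) ≤ Real.Gamma (1 / 2) * Nat.factorial p := by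
  induction p with
  | zero => simp
  | succ k ih =>
    have h : ((k + 1 : ℕ) : ℝ) + 1 / 2 = ((k : ℝ) + 1 / 2) + 1 := by push_cast; ring
    rw [h, Real.Gamma_add_one (by positivity), Nat.factorial_succ]
    push_cast
    have h2 := Gamma_nat_add_half_pos k
    calc ((k : ℝ) + 1 / 2) * Real.Gamma ((k : ℝ) + 1 / 2)
        ≤ ((k : ℝ) + 1) * (Real.Gamma (1 / 2) * Nat.factorial k) := by
          gcongr; linarith
      _ = _ := by ring

theorem gammaCoeff_pos (p : ℕ) : 0 < gammaCoeff p :=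
  div_pos (Gamma_nat_add_half_pos p) (by positivity)

theorem gammaCoeff_le (p : ℕ) : gammaCoeff p ≤ Real.Gamma (1 / 2) / Nat.factorial p := by
  have h1 : (1 : ℝ) ≤ p + 1 := by linarith [p.cast_nonneg (α := ℝ)]
  have h2 : (0 : ℝ) < Nat.factorial p := by positivity
  have h3 : 0 < Real.Gamma (1 / 2) := Real.Gamma_pos_of_pos (by norm_num)
  rw [gammaCoeff, div_le_div_iff₀ (by positivity) h2, Nat.factorial_succ]
  push_cast
  calc Real.Gamma ((p : ℝ) + 1 / 2) * Nat.factorial p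
      ≤ Real.Gamma (1 / 2) * Nat.factorial p * Nat.factorial p := by
        gcongr; exact Gamma_nat_add_half_le p
    _ = Real.Gamma (1 / 2) * (Nat.factorial p * (1 * Nat.factorial p)) := by ring
    _ ≤ _ := by gcongr

theorem summable_gammaCoeff_mul_pow (x : ℝ) : Summable fun p => gammaCoeff p * x ^ (2 * p) := by
  refine Summable.of_nonneg_of_le (fun p => mul_nonneg (gammaCoeff_pos p).le ?_) (fun p => ?_)
    ((Real.summable_pow_div_factorial (x ^ 2)).mul_left (Real.Gamma (1 / 2)))
  · rw [pow_mul]; positivity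
  · rw [pow_mul]
    calc gammaCoeff p * (x ^ 2) ^ p ≤ Real.Gamma (1 / 2) / Nat.factorial p * (x ^ 2) ^ p := by
          gcongr; exact gammaCoeff_le p
      _ = _ := by ring

theorem norm_gammaCoeff_mul_pow (z : ℂ) (p n : ℕ) :
    ‖(gammaCoeff p : ℂ) * z ^ n‖ = gammaCoeff p * ‖z‖ ^ n := by
  rw [norm_mul, norm_pow, Complex.norm_real, Real.norm_of_nonneg (gammaCoeff_pos p).le]

theorem summable_gammaCoeff_mul_cpow (z : ℂ) :
    Summable fun p => (gammaCoeff p : ℂ) * z ^ (2 * p) :=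
  .of_norm (by simpa only [norm_gammaCoeff_mul_pow] using summable_gammaCoeff_mul_pow ‖z‖)

theorem differentiable_tsum_gammaCoeff :
    Differentiable ℂ fun z : ℂ => ∑' p, (gammaCoeff p : ℂ) * z ^ (2 * p) := by
  intro z
  have hz : z ∈ Metric.ball (0 : ℂ) (‖z‖ + 1) := by simp
  refine (Complex.differentiableOn_tsum_of_summable_norm (summable_gammaCoeff_mul_pow (‖z‖ + 1))
    (fun p => ?_) Metric.isOpen_ball fun p w hw => ?_).differentiableAt
      (Metric.isOpen_ball.mem_nhds hz)
  · fun_prop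
  · rw [norm_gammaCoeff_mul_pow]
    have := gammaCoeff_pos p
    have hw' : ‖w‖ ≤ ‖z‖ + 1 := by simpa using (mem_ball_zero_iff.mp hw).le
    gcongr

theorem integral_cos_pow_add_two (n : ℕ) :
    ∫ θ in (0 : ℝ)..(2 * Real.pi), Real.cos θ ^ (n + 2) =
      (n + 1) / (n + 2) * ∫ θ in (0 : ℝ)..(2 * Real.pi), Real.cos θ ^ n := by
  rw [integral_cos_pow]; simp

theorem integral_cos_pow_odd (p : ℕ) :
    ∫ θ in (0 : ℝ)..(2 * Real.pi), Real.cos θ ^ (2 * p + 1) = 0 := by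
  induction p with
  | zero => simp
  | succ k ih =>
    rw [show 2 * (k + 1) + 1 = (2 * k + 1) + 2 by ring, integral_cos_pow_add_two, ih, mul_zero]

theorem integral_cos_pow_even (p : ℕ) :
    ∫ θ in (0 : ℝ)..(2 * Real.pi), Real.cos θ ^ (2 * p) =
      2 * Real.pi * (2 * p).factorial / (4 ^ p * (p.factorial : ℝ) ^ 2) := by
  induction p with
  | zero => simp
  | succ k ih =>
    rw [show 2 * (k + 1) = 2 * k + 2 by ring, integral_cos_pow_add_two, ih,
      Nat.factorial_succ (2 * k + 1), Nat.factorial_succ (2 * k), Nat.factorial_succ k]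
    push_cast
    field_simp
    ring

theorem hasSum_integral_exp_cos_mul_cos (w : ℂ) :
    HasSum (fun p : ℕ => 2 * (Real.pi : ℂ) * w ^ (2 * p + 1) /
        ((p.factorial : ℂ) * ((p + 1).factorial : ℂ)))
      (∫ θ in (0 : ℝ)..(2 * Real.pi),
        Complex.exp (2 * w * (Real.cos θ : ℂ)) * (Real.cos θ : ℂ)) := by
  have hterm (n : ℕ) : ∫ θ in (0 : ℝ)..(2 * Real.pi),
      (2 * w * (Real.cos θ : ℂ)) ^ n / (n.factorial : ℂ) * (Real.cos θ : ℂ) =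
      (2 * w) ^ n / (n.factorial : ℂ) *
        ((∫ θ in (0 : ℝ)..(2 * Real.pi), Real.cos θ ^ (n + 1) : ℝ) : ℂ) := by
    rw [← intervalIntegral.integral_ofReal, ← intervalIntegral.integral_const_mul]
    congr 1 with θ
    push_cast
    ring
  have key : HasSum (fun n : ℕ => ∫ θ in (0 : ℝ)..(2 * Real.pi),
      (2 * w * (Real.cos θ : ℂ)) ^ n / (n.factorial : ℂ) * (Real.cos θ : ℂ))
      (∫ θ in (0 : ℝ)..(2 * Real.pi),
        Complex.exp (2 * w * (Real.cos θ : ℂ)) * (Real.cos θ : ℂ)) := by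
    refine intervalIntegral.hasSum_integral_of_dominated_convergence
      (fun n _ => ‖2 * w‖ ^ n / n.factorial) (fun n => ?_) (fun n => ?_) ?_ ?_ ?_
    · exact Continuous.aestronglyMeasurable (by fun_prop)
    · refine .of_forall fun θ _ => ?_
      have hc : ‖(Real.cos θ : ℂ)‖ ≤ 1 := by
        rw [Complex.norm_real]; exact Real.abs_cos_le_one θ
      rw [norm_mul, norm_div, norm_pow, norm_mul (2 * w), Complex.norm_natCast]
      calc (‖2 * w‖ * ‖(Real.cos θ : ℂ)‖) ^ n / n.factorial * ‖(Real.cos θ : ℂ)‖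
          ≤ (‖2 * w‖ * 1) ^ n / n.factorial * 1 := by gcongr
        _ = _ := by ring
    · exact .of_forall fun θ _ => Real.summable_pow_div_factorial _
    · exact intervalIntegrable_const
    · refine .of_forall fun θ _ => ?_
      have h := NormedSpace.expSeries_div_hasSum_exp (2 * w * (Real.cos θ : ℂ))
      rw [← Complex.exp_eq_exp_ℂ] at h
      exact h.mul_right (Real.cos θ : ℂ)
  simp only [hterm] at key
  have hinj : Function.Injective fun p : ℕ => 2 * p + 1 := fun a b h => by
    simp only at h; omega
  rw [← hinj.hasSum_iff] at key
  · convert key using 2 with p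
    simp only [Function.comp]
    rw [show 2 * p + 1 + 1 = 2 * (p + 1) by ring, integral_cos_pow_even,
      show 2 * (p + 1) = 2 * p + 1 + 1 by ring, Nat.factorial_succ (2 * p + 1),
      Nat.factorial_succ p]
    have h1 : ((2 * p + 1).factorial : ℂ) ≠ 0 := by exact_mod_cast Nat.factorial_ne_zero _
    have h2 : (p.factorial : ℂ) ≠ 0 := by exact_mod_cast Nat.factorial_ne_zero _
    have h3 : (p : ℂ) + 1 ≠ 0 := by exact_mod_cast p.succ_ne_zero
    push_cast
    rw [mul_pow, show (4 : ℂ) = 2 ^ 2 by norm_num, ← pow_mul]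
    field_simp
    ring
  · intro n hn
    rcases Nat.even_or_odd' n with ⟨k, rfl | rfl⟩
    · rw [integral_cos_pow_odd]; simp
    · exact absurd ⟨k, rfl⟩ hn

theorem integrableOn_pow_mul_exp_neg_sq (p : ℕ) :
    IntegrableOn (fun r : ℝ => r ^ (2 * p) * Real.exp (-r ^ 2)) (Set.Ioi 0) := by
  have h := integrableOn_rpow_mul_exp_neg_mul_sq one_pos (s := ((2 * p : ℕ) : ℝ))
    (by linarith [(2 * p).cast_nonneg (α := ℝ)])
  simpa only [Real.rpow_natCast, neg_mul, one_mul] using h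

theorem integral_pow_mul_exp_neg_sq (p : ℕ) :
    ∫ r in Set.Ioi (0 : ℝ), r ^ (2 * p) * Real.exp (-r ^ 2) =
      Real.Gamma ((p : ℝ) + 1 / 2) / 2 := by
  have h := integral_rpow_mul_exp_neg_rpow (p := 2) (q := ((2 * p : ℕ) : ℝ)) two_pos
    (by linarith [(2 * p).cast_nonneg (α := ℝ)])
  simp only [Real.rpow_natCast, Real.rpow_two] at h
  rw [h, show (((2 * p : ℕ) : ℝ) + 1) / 2 = (p : ℝ) + 1 / 2 by push_cast; ring]
  ring

theorem hasSum_M3int (z : ℂ) :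
    HasSum (fun p : ℕ => (Real.pi : ℂ) * ((gammaCoeff p : ℂ) * z ^ (2 * p + 1))) (M3int z) := by
  set c : ℕ → ℂ := fun p =>
    2 * (Real.pi : ℂ) * z ^ (2 * p + 1) / ((p.factorial : ℂ) * ((p + 1).factorial : ℂ)) with hc
  set F : ℕ → ℝ → ℂ := fun p r => c p * ((r ^ (2 * p) * Real.exp (-r ^ 2) : ℝ) : ℂ) with hF
  have hF_integral (p : ℕ) : ∫ r in Set.Ioi (0 : ℝ), F p r =
      (Real.pi : ℂ) * ((gammaCoeff p : ℂ) * z ^ (2 * p + 1)) := by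
    simp only [hF, hc]
    rw [integral_const_mul, integral_complex_ofReal, integral_pow_mul_exp_neg_sq, gammaCoeff]
    push_cast
    ring
  have hF_norm (p : ℕ) : ∫ r in Set.Ioi (0 : ℝ), ‖F p r‖ =
      Real.pi * ‖z‖ * (gammaCoeff p * ‖z‖ ^ (2 * p)) := by
    have h (r : ℝ) : ‖F p r‖ = ‖c p‖ * (r ^ (2 * p) * Real.exp (-r ^ 2)) := by
      rw [hF, norm_mul, Complex.norm_real, Real.norm_of_nonneg]
      rw [pow_mul]
      positivity
    simp only [h]
    rw [integral_const_mul, integral_pow_mul_exp_neg_sq, gammaCoeff, hc]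
    simp only [norm_div, norm_mul, norm_pow, Complex.norm_natCast, Complex.norm_real,
      Real.norm_of_nonneg Real.pi_pos.le, Complex.norm_ofNat]
    ring
  have key := hasSum_integral_of_summable_integral_norm
    (μ := volume.restrict (Set.Ioi (0 : ℝ))) (F := F)
    (fun p => ((integrableOn_pow_mul_exp_neg_sq p).ofReal).const_mul (c p))
    (by simpa only [hF_norm] using (summable_gammaCoeff_mul_pow ‖z‖).mul_left (Real.pi * ‖z‖))
  simp only [hF_integral] at key
  suffices h : M3int z = ∫ r in Set.Ioi (0 : ℝ), ∑' p, F p r from h ▸ key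
  refine setIntegral_congr_fun measurableSet_Ioi fun r hr => ?_
  have hr0 : (r : ℂ) ≠ 0 := by exact_mod_cast (ne_of_gt hr)
  have h := (hasSum_integral_exp_cos_mul_cos ((r : ℂ) * z)).mul_left
    ((r : ℂ)⁻¹ * Complex.exp (-(r : ℂ) ^ 2))
  simp only [← mul_assoc (2 : ℂ) (r : ℂ) z] at h
  rw [← h.tsum_eq]
  congr 1 with p
  simp only [hF, hc]
  push_cast
  field_simp
  ring

theorem M3_eq_tsum {z : ℂ} (hz : z ≠ 0) :
    M3 z = (Real.pi : ℂ) * ∑' p, (gammaCoeff p : ℂ) * z ^ (2 * p) := by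
  rw [M3, ← (hasSum_M3int z).tsum_eq, ← tsum_mul_left, ← tsum_mul_left]
  congr 1 with p
  field_simp
  ring

/-- The integral `∫₀^∞ r⁻¹ e^{-r²} (∫₀^{2π} e^{2rz cos θ} cos θ dθ) dr` equals
`π Σ_{p} Γ(p+1/2)/(p!(p+1)!) z^{2p+1}`, a power series with infinite radius of convergence;
hence for `z ≠ 0`, `M₃(z) = π Σ_p Γ(p+1/2)/(p!(p+1)!) z^{2p}` and `M₃` extends to an
entire function. -/
theorem stmt2 :
    (∀ z : ℂ, Summable (fun p : ℕ =>
        ((Real.Gamma ((p : ℝ) + 1 / 2) /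
            ((Nat.factorial p : ℝ) * (Nat.factorial (p + 1) : ℝ)) : ℝ) : ℂ)
          * z ^ (2 * p + 1))) ∧
    (∀ z : ℂ, M3int z =
        (Real.pi : ℂ) * ∑' p : ℕ,
          ((Real.Gamma ((p : ℝ) + 1 / 2) /
              ((Nat.factorial p : ℝ) * (Nat.factorial (p + 1) : ℝ)) : ℝ) : ℂ)
            * z ^ (2 * p + 1)) ∧
    (∀ z : ℂ, z ≠ 0 → M3 z =
        (Real.pi : ℂ) * ∑' p : ℕ,
          ((Real.Gamma ((p : ℝ) + 1 / 2) /
              ((Nat.factorial p : ℝ) * (Nat.factorial (p + 1) : ℝ)) : ℝ) : ℂ)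
            * z ^ (2 * p)) ∧
    (∃ g : ℂ → ℂ, Differentiable ℂ g ∧ ∀ z : ℂ, z ≠ 0 → g z = M3 z) := by
  refine ⟨fun z => ?_, fun z => ?_, fun z hz => M3_eq_tsum hz,
    fun z => (Real.pi : ℂ) * ∑' p, (gammaCoeff p : ℂ) * z ^ (2 * p),
    differentiable_tsum_gammaCoeff.const_mul _, fun z hz => (M3_eq_tsum hz).symm⟩
  · simpa only [pow_succ, ← mul_assoc, gammaCoeff]
      using (summable_gammaCoeff_mul_cpow z).mul_right z
  · rw [← (hasSum_M3int z).tsum_eq, tsum_mul_left]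
    rfl
end

section
/- For every ε>0, every η₀∈ℝ² with 0<|η₀|≤ε, and every ψ∈ℝ², one has ∫_{ℝ²} α_{ε,η₀}(η)·(⟨ψ,η⟩/|η|³)·η dη = (e^{−r̄₀²}/ε)·[ (M₅(r̄₀) − M₁(r̄₀))·ψ + (2M₁(r̄₀) − M₅(r̄₀))·⟨ψ,u₀⟩·u₀ ], where r̄₀ = |η₀|/ε and u₀ = η₀/|η₀| (the integral converges absolutely). Equivalently, the quantity a₃ := −(1/(8π))∫_{ℝ²} α_{ε,η₀}(η)·(⟨ψ,η/|η|⟩/|η|)·(η/|η|) dη equals −(1/(8π))·(e^{−r̄₀²}/ε)·[ (M₅(r̄₀)−M₁(r̄₀))ψ + (2M₁(r̄₀)−M₅(r̄₀))⟨ψ,u₀⟩u₀ ]. -/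
open MeasureTheory
open scoped RealInnerProductSpace

/-- `M₁(z) = ∫₀^∞ e^{-r²} (∫₀^{2π} e^{2rz cos θ} cos²θ dθ) dr` (real argument). -/
noncomputable def M1R (z : ℝ) : ℝ :=
  ∫ r in Set.Ioi (0 : ℝ),
    Real.exp (-r ^ 2) *
      ∫ θ in (0 : ℝ)..(2 * Real.pi),
        Real.exp (2 * r * z * Real.cos θ) * Real.cos θ ^ 2

/-- `M₅(z) = ∫₀^∞ e^{-r²} (∫₀^{2π} e^{2rz cos θ} dθ) dr` (real argument). -/
noncomputable def M5R (z : ℝ) : ℝ :=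
  ∫ r in Set.Ioi (0 : ℝ),
    Real.exp (-r ^ 2) *
      ∫ θ in (0 : ℝ)..(2 * Real.pi), Real.exp (2 * r * z * Real.cos θ)

/-- Integrability on the plane, expressed in polar coordinates. -/
theorem integrableOn_polarCoord_symm_iff {F : Type*} [NormedAddCommGroup F] [NormedSpace ℝ F]
    (f : ℝ × ℝ → F) :
    IntegrableOn (fun p => p.1 • f (polarCoord.symm p)) polarCoord.target ↔ Integrable f := by
  have hm : MeasurableSet polarCoord.target := polarCoord.open_target.measurableSet
  have h := integrableOn_image_iff_integrableOn_abs_det_fderiv_smul volume hm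
    (fun p _ => (hasFDerivAt_polarCoord_symm p).hasFDerivWithinAt) polarCoord.symm.injOn f
  rw [polarCoord.symm_image_target_eq_source,
    integrableOn_congr_set_ae polarCoord_source_ae_eq_univ, integrableOn_univ] at h
  rw [h]
  refine integrableOn_congr_fun (fun p hp => ?_) hm
  simp only [det_fderivPolarCoordSymm, abs_of_pos (show 0 < p.1 from hp.1)]

section OrthonormalBasis

variable {E : Type*} [NormedAddCommGroup E] [InnerProductSpace ℝ E] [FiniteDimensional ℝ E]
  [MeasurableSpace E] [BorelSpace E]

/-- The coordinates `(x, y) ↦ x • b 0 + y • b 1` of an orthonormal basis preserve volume. -/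
theorem OrthonormalBasis.exists_measurableEquiv_prod (b : OrthonormalBasis (Fin 2) ℝ E) :
    ∃ e : ℝ × ℝ ≃ᵐ E, MeasurePreserving e ∧ ∀ p, e p = p.1 • b 0 + p.2 • b 1 := by
  refine ⟨(MeasurableEquiv.finTwoArrow.symm.trans
    (MeasurableEquiv.toLp 2 (Fin 2 → ℝ))).trans b.measurableEquiv.symm, ?_, fun p => ?_⟩
  · exact ((volume_preserving_finTwoArrow ℝ).symm.trans
      (PiLp.volume_preserving_toLp (Fin 2))).trans b.measurePreserving_measurableEquiv.symm
  · change b.repr.symm (WithLp.toLp 2 ![p.1, p.2]) = _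
    rw [← b.sum_repr_symm]
    simp [Fin.sum_univ_two]

theorem OrthonormalBasis.integrable_iff_polar {F : Type*} [NormedAddCommGroup F]
    [NormedSpace ℝ F] (b : OrthonormalBasis (Fin 2) ℝ E) (f : E → F) :
    Integrable f ↔ IntegrableOn
      (fun p : ℝ × ℝ => p.1 • f (p.1 • (Real.cos p.2 • b 0 + Real.sin p.2 • b 1)))
      (Set.Ioi 0 ×ˢ Set.Ioo (-Real.pi) Real.pi) := by
  obtain ⟨e, he, hv⟩ := b.exists_measurableEquiv_prod
  rw [← he.integrable_comp_emb e.measurableEmbedding, ← integrableOn_polarCoord_symm_iff]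
  simp [polarCoord_target, hv, smul_smul]

theorem OrthonormalBasis.integral_eq_polar {F : Type*} [NormedAddCommGroup F]
    [NormedSpace ℝ F] (b : OrthonormalBasis (Fin 2) ℝ E) (f : E → F) :
    ∫ x, f x = ∫ p in Set.Ioi (0 : ℝ) ×ˢ Set.Ioo (-Real.pi) Real.pi,
      p.1 • f (p.1 • (Real.cos p.2 • b 0 + Real.sin p.2 • b 1)) := by
  obtain ⟨e, he, hv⟩ := b.exists_measurableEquiv_prod
  rw [← he.integral_comp e.measurableEmbedding, ← integral_comp_polarCoord_symm]
  simp [polarCoord_target, hv, smul_smul]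

end OrthonormalBasis

/-- The density `e^{-r²} e^{2rz cos θ} g(θ)` in polar coordinates `(r, θ)`. -/
noncomputable def polarDensity (z : ℝ) (g : ℝ → ℝ) (p : ℝ × ℝ) : ℝ :=
  Real.exp (-p.1 ^ 2) * (Real.exp (2 * p.1 * z * Real.cos p.2) * g p.2)

theorem integrableOn_polarDensity (z : ℝ) {g : ℝ → ℝ} (hg : Continuous g)
    (hb : ∀ θ, |g θ| ≤ 1) :
    IntegrableOn (polarDensity z g) (Set.Ioi 0 ×ˢ Set.Ioo (-Real.pi) Real.pi) := by
  have hr : IntegrableOn (fun r : ℝ => Real.exp (2 * z ^ 2) * Real.exp (-(1 / 2) * r ^ 2))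
      (Set.Ioi 0) :=
    ((integrable_exp_neg_mul_sq (by norm_num)).const_mul _).integrableOn
  have hθ : IntegrableOn (fun _ : ℝ => (1 : ℝ)) (Set.Ioo (-Real.pi) Real.pi) := by simp
  have hd := Integrable.mul_prod hr hθ
  rw [Measure.prod_restrict] at hd
  refine Integrable.mono' hd ?_ (ae_of_all _ fun p => ?_)
  · have : Continuous (polarDensity z g) := by unfold polarDensity; fun_prop
    exact this.aestronglyMeasurable
  · rw [polarDensity, ← mul_assoc, ← Real.exp_add, norm_mul, Real.norm_eq_abs, Real.abs_exp,
      ← Real.exp_add]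
    refine mul_le_mul (Real.exp_le_exp.2 ?_) (hb _) (norm_nonneg _) (Real.exp_pos _).le
    nlinarith [sq_nonneg (p.1 - 2 * z * Real.cos p.2), Real.cos_sq_le_one p.2, sq_nonneg z,
      mul_le_mul_of_nonneg_left (Real.cos_sq_le_one p.2) (sq_nonneg z)]

theorem integral_polarDensity (z : ℝ) {g : ℝ → ℝ} (hg : Continuous g) (hb : ∀ θ, |g θ| ≤ 1) :
    ∫ p in Set.Ioi (0 : ℝ) ×ˢ Set.Ioo (-Real.pi) Real.pi, polarDensity z g p =
      ∫ r in Set.Ioi (0 : ℝ), Real.exp (-r ^ 2) *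
        ∫ θ in (-Real.pi)..Real.pi, Real.exp (2 * r * z * Real.cos θ) * g θ := by
  have h := integrableOn_polarDensity z hg hb
  rw [Measure.volume_eq_prod] at h ⊢
  rw [setIntegral_prod _ h]
  congr 1 with r
  rw [intervalIntegral.integral_of_le (by linarith [Real.pi_pos]), integral_Ioc_eq_integral_Ioo,
    ← integral_const_mul]
  rfl

theorem integral_neg_pi_pi_eq {f : ℝ → ℝ} (hf : Function.Periodic f (2 * Real.pi)) :
    ∫ θ in (-Real.pi)..Real.pi, f θ = ∫ θ in (0 : ℝ)..(2 * Real.pi), f θ := by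
  have h := hf.intervalIntegral_add_eq (-Real.pi) 0
  rwa [zero_add, show -Real.pi + 2 * Real.pi = Real.pi by ring] at h

theorem integral_polarDensity_cos_sq (z : ℝ) :
    ∫ p in Set.Ioi (0 : ℝ) ×ˢ Set.Ioo (-Real.pi) Real.pi,
      polarDensity z (fun θ => Real.cos θ ^ 2) p = M1R z := by
  rw [integral_polarDensity z (by fun_prop) fun θ => by
    rw [abs_of_nonneg (sq_nonneg _)]; exact Real.cos_sq_le_one θ, M1R]
  congr 1 with r
  rw [integral_neg_pi_pi_eq]
  intro θ
  simp

theorem integral_polarDensity_one (z : ℝ) :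
    ∫ p in Set.Ioi (0 : ℝ) ×ˢ Set.Ioo (-Real.pi) Real.pi,
      polarDensity z (fun _ => 1) p = M5R z := by
  rw [integral_polarDensity z (by fun_prop) (by simp), M5R]
  congr 1 with r
  rw [integral_neg_pi_pi_eq]
  · simp
  · intro θ
    simp

theorem integral_polarDensity_sin_sq (z : ℝ) :
    ∫ p in Set.Ioi (0 : ℝ) ×ˢ Set.Ioo (-Real.pi) Real.pi,
      polarDensity z (fun θ => Real.sin θ ^ 2) p = M5R z - M1R z := by
  rw [← integral_polarDensity_one, ← integral_polarDensity_cos_sq, ← integral_sub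
    (integrableOn_polarDensity z (by fun_prop) (by simp))
    (integrableOn_polarDensity z (by fun_prop) fun θ => by
      rw [abs_of_nonneg (sq_nonneg _)]; exact Real.cos_sq_le_one θ)]
  congr 1 with p
  simp only [polarDensity, Real.sin_sq]
  ring

theorem abs_cos_mul_sin_le_one (θ : ℝ) : |Real.cos θ * Real.sin θ| ≤ 1 := by
  rw [abs_mul]
  exact mul_le_one₀ (Real.abs_cos_le_one θ) (abs_nonneg _) (Real.abs_sin_le_one θ)

theorem integral_polarDensity_cos_mul_sin (z : ℝ) :
    ∫ p in Set.Ioi (0 : ℝ) ×ˢ Set.Ioo (-Real.pi) Real.pi,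
      polarDensity z (fun θ => Real.cos θ * Real.sin θ) p = 0 := by
  rw [integral_polarDensity z (by fun_prop) abs_cos_mul_sin_le_one]
  refine integral_eq_zero_of_ae (ae_of_all _ fun r => ?_)
  have h := intervalIntegral.integral_comp_neg (a := -Real.pi) (b := Real.pi)
    fun θ => Real.exp (2 * r * z * Real.cos θ) * (Real.cos θ * Real.sin θ)
  simp only [Real.cos_neg, Real.sin_neg, mul_neg, intervalIntegral.integral_neg, neg_neg] at h
  simp only [Pi.zero_apply, mul_eq_zero]
  right
  linarith

/-- A unit vector of the plane is the first vector of some orthonormal basis. -/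
theorem exists_orthonormalBasis_zero_eq {u : EuclideanSpace ℝ (Fin 2)} (hu : ‖u‖ = 1) :
    ∃ b : OrthonormalBasis (Fin 2) ℝ (EuclideanSpace ℝ (Fin 2)), b 0 = u := by
  have ho : Orthonormal ℝ (({0} : Set (Fin 2)).domRestrict fun _ => u) :=
    ⟨fun _ => hu, fun i j hij => (hij (Subsingleton.elim i j)).elim⟩
  obtain ⟨b, hb⟩ := ho.exists_orthonormalBasis_extension_of_card_eq (by simp)
  exact ⟨b, hb 0 rfl⟩

theorem OrthonormalBasis.norm_sq_smul_add_smul {E : Type*} [NormedAddCommGroup E]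
    [InnerProductSpace ℝ E] (b : OrthonormalBasis (Fin 2) ℝ E) (x y : ℝ) :
    ‖x • b 0 + y • b 1‖ ^ 2 = x ^ 2 + y ^ 2 := by
  rw [norm_add_sq_real, norm_smul, norm_smul, inner_smul_left, inner_smul_right,
    b.inner_eq_zero (by decide)]
  simp

/-- The integrand of `stmt9`, rescaled by `ε` and written in polar coordinates. -/
theorem polar_integrand_eq {ε : ℝ} (hε : 0 < ε) (ψ : EuclideanSpace ℝ (Fin 2)) (z : ℝ)
    (b : OrthonormalBasis (Fin 2) ℝ (EuclideanSpace ℝ (Fin 2))) {p : ℝ × ℝ} (hp : 0 < p.1)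
    {η : EuclideanSpace ℝ (Fin 2)}
    (hη : η = ε • p.1 • (Real.cos p.2 • b 0 + Real.sin p.2 • b 1)) :
    p.1 • (alphaFn ε ((ε * z) • b 0) η * ⟪ψ, η⟫ / ‖η‖ ^ 3) • η =
      (Real.exp (-z ^ 2) / ε ^ 3) •
        (polarDensity z (fun θ => Real.cos θ ^ 2) p • ⟪ψ, b 0⟫ • b 0 +
          polarDensity z (fun θ => Real.cos θ * Real.sin θ) p •
            (⟪ψ, b 1⟫ • b 0 + ⟪ψ, b 0⟫ • b 1) +
          polarDensity z (fun θ => Real.sin θ ^ 2) p • ⟪ψ, b 1⟫ • b 1) := by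
  obtain ⟨r, θ⟩ := p
  dsimp only at hp hη ⊢
  have hw : ‖Real.cos θ • b 0 + Real.sin θ • b 1‖ = 1 := by
    rw [← pow_left_inj₀ (norm_nonneg _) zero_le_one two_ne_zero, b.norm_sq_smul_add_smul]
    simp
  have hn : ‖η‖ = ε * r := by
    rw [hη, norm_smul, norm_smul, hw, Real.norm_of_nonneg hε.le, Real.norm_of_nonneg hp.le,
      mul_one]
  have hd : ‖η - (ε * z) • b 0‖ ^ 2 = ε ^ 2 * (r ^ 2 - 2 * r * z * Real.cos θ + z ^ 2) := by
    have : η - (ε * z) • b 0 =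
        (ε * (r * Real.cos θ - z)) • b 0 + (ε * r * Real.sin θ) • b 1 := by
      rw [hη]; module
    rw [this, b.norm_sq_smul_add_smul]
    linear_combination (ε ^ 2 * r ^ 2) * Real.sin_sq_add_cos_sq θ
  have ha : alphaFn ε ((ε * z) • b 0) η =
      ε⁻¹ ^ 2 * (Real.exp (-z ^ 2) * (Real.exp (-r ^ 2) * Real.exp (2 * r * z * Real.cos θ))) := by
    rw [alphaFn, hd, ← Real.exp_add, ← Real.exp_add]
    congr 2
    field_simp
    ring
  have hi : ⟪ψ, η⟫ = ε * r * (Real.cos θ * ⟪ψ, b 0⟫ + Real.sin θ * ⟪ψ, b 1⟫) := by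
    rw [hη]
    simp only [inner_smul_right, inner_add_right]
    ring
  rw [ha, hi, hn, hη]
  simp only [polarDensity]
  match_scalars <;> field_simp

/-- For `ε > 0`, `η₀ ∈ ℝ²` with `0 < |η₀| ≤ ε`, and `ψ ∈ ℝ²`, the absolutely convergent
integral `∫_{ℝ²} α_{ε,η₀}(η) (⟨ψ,η⟩/|η|³) η dη` equals
`(e^{−r̄₀²}/ε)[(M₅(r̄₀) − M₁(r̄₀)) ψ + (2M₁(r̄₀) − M₅(r̄₀)) ⟨ψ,u₀⟩ u₀]`; equivalently,
`a₃ := −(1/(8π)) ∫_{ℝ²} α_{ε,η₀}(η) (⟨ψ,η/|η|⟩/|η|) (η/|η|) dη` equals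
`−(1/(8π)) (e^{−r̄₀²}/ε)[(M₅(r̄₀)−M₁(r̄₀)) ψ + (2M₁(r̄₀)−M₅(r̄₀)) ⟨ψ,u₀⟩ u₀]`. -/
theorem stmt9 (ε : ℝ) (hε : 0 < ε) (η₀ ψ : EuclideanSpace ℝ (Fin 2))
    (h0 : 0 < ‖η₀‖) (h1 : ‖η₀‖ ≤ ε)
    (r0 : ℝ) (hr0 : r0 = ‖η₀‖ / ε)
    (u0 : EuclideanSpace ℝ (Fin 2)) (hu0 : u0 = ‖η₀‖⁻¹ • η₀) :
    Integrable (fun η : EuclideanSpace ℝ (Fin 2) =>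
      (alphaFn ε η₀ η * ⟪ψ, η⟫ / ‖η‖ ^ 3) • η) ∧
    (∫ η : EuclideanSpace ℝ (Fin 2), (alphaFn ε η₀ η * ⟪ψ, η⟫ / ‖η‖ ^ 3) • η) =
      (Real.exp (-r0 ^ 2) / ε) •
        ((M5R r0 - M1R r0) • ψ + ((2 * M1R r0 - M5R r0) * ⟪ψ, u0⟫) • u0) ∧
    (-(1 / (8 * Real.pi)) •
        ∫ η : EuclideanSpace ℝ (Fin 2),
          (alphaFn ε η₀ η * ⟪ψ, ‖η‖⁻¹ • η⟫ / ‖η‖) • (‖η‖⁻¹ • η)) =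
      (-(1 / (8 * Real.pi)) * (Real.exp (-r0 ^ 2) / ε)) •
        ((M5R r0 - M1R r0) • ψ + ((2 * M1R r0 - M5R r0) * ⟪ψ, u0⟫) • u0) := by
  have hr0' : ‖η₀‖ = ε * r0 := by rw [hr0]; field_simp
  have hu : ‖u0‖ = 1 := by
    rw [hu0, norm_smul, norm_inv, norm_norm, inv_mul_cancel₀ h0.ne']
  obtain ⟨b, rfl⟩ := exists_orthonormalBasis_zero_eq hu
  have hη₀ : η₀ = (ε * r0) • b 0 := by
    rw [hu0, ← hr0', smul_smul, mul_inv_cancel₀ h0.ne', one_smul]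
  set S : Set (ℝ × ℝ) := Set.Ioi (0 : ℝ) ×ˢ Set.Ioo (-Real.pi) Real.pi with hS
  have hSm : MeasurableSet S := measurableSet_Ioi.prod measurableSet_Ioo
  set F : EuclideanSpace ℝ (Fin 2) → EuclideanSpace ℝ (Fin 2) := fun η =>
    (alphaFn ε η₀ η * ⟪ψ, η⟫ / ‖η‖ ^ 3) • η with hF
  have hpol : Set.EqOn
      (fun p : ℝ × ℝ => p.1 • F (ε • p.1 • (Real.cos p.2 • b 0 + Real.sin p.2 • b 1)))
      _ S := fun p hp => by
    simp only [hF, hη₀]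
    exact polar_integrand_eq hε ψ r0 b hp.1 rfl
  have hcc := (integrableOn_polarDensity r0 (g := fun θ => Real.cos θ ^ 2) (by fun_prop) fun θ => by
    rw [abs_of_nonneg (sq_nonneg _)]; exact Real.cos_sq_le_one θ).smul_const (⟪ψ, b 0⟫ • b 0)
  have hss := (integrableOn_polarDensity r0 (g := fun θ => Real.sin θ ^ 2) (by fun_prop) fun θ => by
    rw [abs_of_nonneg (sq_nonneg _)]; exact Real.sin_sq_le_one θ).smul_const (⟪ψ, b 1⟫ • b 1)
  have hcs := (integrableOn_polarDensity r0 (g := fun θ => Real.cos θ * Real.sin θ) (by fun_prop)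
    abs_cos_mul_sin_le_one).smul_const (⟪ψ, b 1⟫ • b 0 + ⟪ψ, b 0⟫ • b 1)
  have hccs : IntegrableOn (fun p =>
      polarDensity r0 (fun θ => Real.cos θ ^ 2) p • ⟪ψ, b 0⟫ • b 0 +
        polarDensity r0 (fun θ => Real.cos θ * Real.sin θ) p •
          (⟪ψ, b 1⟫ • b 0 + ⟪ψ, b 0⟫ • b 1)) S := hcc.add hcs
  have hint : Integrable F := by
    rw [← integrable_comp_smul_iff volume F hε.ne', b.integrable_iff_polar,
      integrableOn_congr_fun hpol hSm]
    exact (hccs.add hss).smul (Real.exp (-r0 ^ 2) / ε ^ 3)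
  have hψ : ψ = ⟪ψ, b 0⟫ • b 0 + ⟪ψ, b 1⟫ • b 1 := by
    conv_lhs => rw [← b.sum_repr' ψ, Fin.sum_univ_two]
    simp only [real_inner_comm]
  have hval : ∫ η, F η = (Real.exp (-r0 ^ 2) / ε) •
      ((M5R r0 - M1R r0) • ψ + ((2 * M1R r0 - M5R r0) * ⟪ψ, b 0⟫) • b 0) := by
    have hs := Measure.integral_comp_smul (volume : Measure (EuclideanSpace ℝ (Fin 2))) F ε
    rw [b.integral_eq_polar, setIntegral_congr_fun hSm hpol, integral_smul,
      integral_add hccs hss, integral_add hcc hcs, integral_smul_const,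
      integral_smul_const, integral_smul_const, integral_polarDensity_cos_sq,
      integral_polarDensity_sin_sq, integral_polarDensity_cos_mul_sin, finrank_euclideanSpace_fin,
      abs_of_pos (by positivity), eq_inv_smul_iff₀ (by positivity)] at hs
    rw [← hs]
    generalize ⟪ψ, b 0⟫ = x at *
    generalize ⟪ψ, b 1⟫ = y at *
    rw [hψ]
    match_scalars <;> field_simp <;> ring
  refine ⟨hint, hval, ?_⟩
  rw [mul_smul, ← hval]
  congr 1
  refine integral_congr_ae (ae_of_all _ fun η => ?_)
  rcases eq_or_ne η 0 with rfl | hη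
  · simp [hF]
  · have : ‖η‖ ≠ 0 := norm_ne_zero_iff.2 hη
    simp only [hF, inner_smul_right, smul_smul]
    congr 1
    field_simp
end

section
/- For every z∈ℂ the following power series identities hold, all series having infinite radius of convergence: M₆(z) = Σ_{p=0}^∞ (2^{2p+1}/(2p)!)·Γ(p+3/2)·I_{2p}·z^{2p}; M₇(z) = Σ_{p=0}^∞ (2^{2p+1}/(2p)!)·Γ(p+3/2)·I_{2p+2}·z^{2p}; M₈(z) = Σ_{p=0}^∞ (2^{2p+1}/(2p)!)·Γ(p+3/2)·I_{2p+4}·z^{2p}; M₉(z) = Σ_{p=0}^∞ (2^{2p+2}/(2p+1)!)·Γ(p+3/2)·I_{2p+2}·z^{2p+1}; M₁₀(z) = Σ_{p=0}^∞ (2^{2p+2}/(2p+1)!)·Γ(p+3/2)·I_{2p+4}·z^{2p+1}. -/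
open MeasureTheory

/-- The Wallis integral `I_k = ∫₀^{π/2} cos^k θ dθ`. -/
noncomputable def Wallis (k : ℕ) : ℝ :=
  ∫ θ in (0 : ℝ)..(Real.pi / 2), Real.cos θ ^ k

/-- `M₆(z) = ∫₀^∞ e^{-r²} r² (∫₀^{2π} e^{2rz cos θ} dθ) dr`. -/
noncomputable def M6 (z : ℂ) : ℂ :=
  ∫ r in Set.Ioi (0 : ℝ),
    Complex.exp (-(r : ℂ) ^ 2) * (r : ℂ) ^ 2 *
      ∫ θ in (0 : ℝ)..(2 * Real.pi),
        Complex.exp (2 * (r : ℂ) * z * (Real.cos θ : ℂ))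

/-- `M₇(z) = ∫₀^∞ e^{-r²} r² (∫₀^{2π} e^{2rz cos θ} cos²θ dθ) dr`. -/
noncomputable def M7 (z : ℂ) : ℂ :=
  ∫ r in Set.Ioi (0 : ℝ),
    Complex.exp (-(r : ℂ) ^ 2) * (r : ℂ) ^ 2 *
      ∫ θ in (0 : ℝ)..(2 * Real.pi),
        Complex.exp (2 * (r : ℂ) * z * (Real.cos θ : ℂ)) * (Real.cos θ : ℂ) ^ 2

/-- `M₈(z) = ∫₀^∞ e^{-r²} r² (∫₀^{2π} e^{2rz cos θ} cos⁴θ dθ) dr`. -/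
noncomputable def M8 (z : ℂ) : ℂ :=
  ∫ r in Set.Ioi (0 : ℝ),
    Complex.exp (-(r : ℂ) ^ 2) * (r : ℂ) ^ 2 *
      ∫ θ in (0 : ℝ)..(2 * Real.pi),
        Complex.exp (2 * (r : ℂ) * z * (Real.cos θ : ℂ)) * (Real.cos θ : ℂ) ^ 4

/-- `M₉(z) = ∫₀^∞ e^{-r²} r (∫₀^{2π} e^{2rz cos θ} cos θ dθ) dr`. -/
noncomputable def M9 (z : ℂ) : ℂ :=
  ∫ r in Set.Ioi (0 : ℝ),
    Complex.exp (-(r : ℂ) ^ 2) * (r : ℂ) *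
      ∫ θ in (0 : ℝ)..(2 * Real.pi),
        Complex.exp (2 * (r : ℂ) * z * (Real.cos θ : ℂ)) * (Real.cos θ : ℂ)

/-- `M₁₀(z) = ∫₀^∞ e^{-r²} r (∫₀^{2π} e^{2rz cos θ} cos³θ dθ) dr`. -/
noncomputable def M10 (z : ℂ) : ℂ :=
  ∫ r in Set.Ioi (0 : ℝ),
    Complex.exp (-(r : ℂ) ^ 2) * (r : ℂ) *
      ∫ θ in (0 : ℝ)..(2 * Real.pi),
        Complex.exp (2 * (r : ℂ) * z * (Real.cos θ : ℂ)) * (Real.cos θ : ℂ) ^ 3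

theorem integral_cos_pow_zero_pi (k : ℕ) :
    ∫ θ in (0 : ℝ)..Real.pi, Real.cos θ ^ k = (1 + (-1) ^ k) * Wallis k := by
  have hi (a b : ℝ) : IntervalIntegrable (fun θ => Real.cos θ ^ k) volume a b :=
    (Real.continuous_cos.pow k).intervalIntegrable a b
  rw [← intervalIntegral.integral_add_adjacent_intervals (hi 0 (Real.pi / 2)) (hi _ _)]
  have h := intervalIntegral.integral_comp_sub_left (a := 0) (b := Real.pi / 2)
    (fun θ => Real.cos θ ^ k) Real.pi
  rw [sub_zero, sub_half] at h
  rw [← h]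
  simp_rw [Real.cos_pi_sub, neg_pow (Real.cos _) k]
  rw [intervalIntegral.integral_const_mul, Wallis]
  ring

theorem integral_cos_pow_zero_two_pi (k : ℕ) :
    ∫ θ in (0 : ℝ)..(2 * Real.pi), Real.cos θ ^ k = (1 + (-1) ^ k) ^ 2 * Wallis k := by
  have hi (a b : ℝ) : IntervalIntegrable (fun θ => Real.cos θ ^ k) volume a b :=
    (Real.continuous_cos.pow k).intervalIntegrable a b
  rw [← intervalIntegral.integral_add_adjacent_intervals (hi 0 Real.pi) (hi _ _)]
  have h := intervalIntegral.integral_comp_add_right (a := 0) (b := Real.pi)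
    (fun θ => Real.cos θ ^ k) Real.pi
  rw [zero_add, ← two_mul] at h
  rw [← h]
  simp_rw [Real.cos_add_pi, neg_pow (Real.cos _) k]
  rw [intervalIntegral.integral_const_mul, integral_cos_pow_zero_pi]
  ring

theorem integral_exp_neg_sq_mul_pow (k : ℕ) :
    ∫ r in Set.Ioi (0 : ℝ), Real.exp (-r ^ 2) * r ^ k = Real.Gamma (((k : ℝ) + 1) / 2) / 2 := by
  have h := integral_rpow_mul_exp_neg_rpow (p := 2) (q := k) two_pos
    (by linarith [Nat.cast_nonneg (α := ℝ) k])
  simp_rw [Real.rpow_natCast, Real.rpow_two] at h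
  simp_rw [mul_comm (Real.exp _)]
  rw [h]
  ring

theorem integrableOn_exp_neg_sq_mul_pow_mul_exp (k : ℕ) (c : ℝ) :
    IntegrableOn (fun r : ℝ => Real.exp (-r ^ 2) * r ^ k * Real.exp (c * r)) (Set.Ioi 0) := by
  have hg := ((integrable_rpow_mul_exp_neg_mul_sq (b := 1 / 2) (by norm_num) (s := k)
    (by linarith [Nat.cast_nonneg (α := ℝ) k])).const_mul
      (Real.exp (c ^ 2 / 2))).integrableOn (s := Set.Ioi 0)
  refine hg.mono' (by fun_prop) ?_
  filter_upwards [ae_restrict_mem measurableSet_Ioi] with r hr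
  have hr' : (0 : ℝ) < r := hr
  rw [Real.norm_of_nonneg (by positivity), Real.rpow_natCast, mul_right_comm, ← Real.exp_add,
    mul_left_comm, ← Real.exp_add, mul_comm]
  refine mul_le_mul_of_nonneg_left (Real.exp_le_exp.mpr ?_) (by positivity)
  nlinarith [sq_nonneg (r - c)]

theorem hasSum_integral_exp_mul_cos_pow (m : ℕ) (w : ℂ) :
    HasSum (fun n : ℕ => w ^ n / (n.factorial : ℂ) *
        (((1 + (-1) ^ (n + m)) ^ 2 * Wallis (n + m) : ℝ) : ℂ))
      (∫ θ in (0 : ℝ)..(2 * Real.pi),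
        Complex.exp (w * (Real.cos θ : ℂ)) * (Real.cos θ : ℂ) ^ m) := by
  have h (n : ℕ) : ∫ θ in (0 : ℝ)..(2 * Real.pi),
      (w ^ n / (n.factorial : ℂ)) * ((Real.cos θ ^ (n + m) : ℝ) : ℂ) =
        w ^ n / (n.factorial : ℂ) * (((1 + (-1) ^ (n + m)) ^ 2 * Wallis (n + m) : ℝ) : ℂ) := by
    rw [intervalIntegral.integral_const_mul, intervalIntegral.integral_ofReal,
      integral_cos_pow_zero_two_pi]
  simp_rw [← h]
  refine intervalIntegral.hasSum_integral_of_dominated_convergence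
    (fun n _ => ‖w‖ ^ n / n.factorial) (fun n => by fun_prop) (fun n => ?_)
    (.of_forall fun _ _ => Real.summable_pow_div_factorial _) (by simp)
    (.of_forall fun θ _ => ?_)
  · refine .of_forall fun θ _ => ?_
    rw [norm_mul, norm_div, norm_pow, Complex.norm_natCast, Complex.norm_real, norm_pow]
    exact mul_le_of_le_one_right (by positivity)
      (pow_le_one₀ (norm_nonneg _) (Real.abs_cos_le_one θ))
  · have he := (NormedSpace.expSeries_div_hasSum_exp (w * (Real.cos θ : ℂ))).mul_right
      ((Real.cos θ : ℂ) ^ m)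
    rw [← Complex.exp_eq_exp_ℂ] at he
    refine he.congr_fun ?_
    intro n
    push_cast
    ring

theorem abs_integral_cos_pow_le (k : ℕ) : |(1 + (-1) ^ k) ^ 2 * Wallis k| ≤ 2 * Real.pi := by
  rw [← integral_cos_pow_zero_two_pi, ← Real.norm_eq_abs]
  have h := intervalIntegral.norm_integral_le_of_norm_le_const (a := 0) (b := 2 * Real.pi)
    (f := fun θ => Real.cos θ ^ k) (C := 1) fun θ _ => by
      rw [norm_pow]
      exact pow_le_one₀ (norm_nonneg _) (Real.abs_cos_le_one θ)
  rwa [sub_zero, one_mul, abs_of_pos Real.two_pi_pos] at h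

theorem hasSum_integral_exp_neg_sq_mul_exp_cos (a m : ℕ) (z : ℂ) :
    HasSum (fun n : ℕ => ((2 ^ n / (n.factorial : ℝ) *
        (Real.Gamma (((n + a : ℕ) + 1) / 2) / 2) *
          ((1 + (-1) ^ (n + m)) ^ 2 * Wallis (n + m)) : ℝ) : ℂ) * z ^ n)
      (∫ r in Set.Ioi (0 : ℝ), Complex.exp (-(r : ℂ) ^ 2) * (r : ℂ) ^ a *
        ∫ θ in (0 : ℝ)..(2 * Real.pi),
          Complex.exp (2 * (r : ℂ) * z * (Real.cos θ : ℂ)) * (Real.cos θ : ℂ) ^ m) := by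
  have h (n : ℕ) : ∫ r in Set.Ioi (0 : ℝ), ((Real.exp (-r ^ 2) * r ^ (n + a) : ℝ) : ℂ) *
      ((2 * z) ^ n / (n.factorial : ℂ) *
        (((1 + (-1) ^ (n + m)) ^ 2 * Wallis (n + m) : ℝ) : ℂ)) =
      ((2 ^ n / (n.factorial : ℝ) * (Real.Gamma (((n + a : ℕ) + 1) / 2) / 2) *
          ((1 + (-1) ^ (n + m)) ^ 2 * Wallis (n + m)) : ℝ) : ℂ) * z ^ n := by
    rw [integral_mul_const, integral_complex_ofReal, integral_exp_neg_sq_mul_pow]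
    push_cast
    ring
  simp_rw [← h]
  have hexp (r : ℝ) : HasSum (fun n : ℕ => Real.exp (-r ^ 2) * r ^ a *
      ((2 * ‖z‖ * r) ^ n / n.factorial) * (2 * Real.pi))
      (Real.exp (-r ^ 2) * r ^ a * Real.exp (2 * ‖z‖ * r) * (2 * Real.pi)) := by
    rw [Real.exp_eq_exp_ℝ]
    exact ((NormedSpace.expSeries_div_hasSum_exp (2 * ‖z‖ * r)).mul_left _).mul_right _
  refine hasSum_integral_of_dominated_convergence
    (fun n r => Real.exp (-r ^ 2) * r ^ a * ((2 * ‖z‖ * r) ^ n / n.factorial) * (2 * Real.pi))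
    (fun n => by fun_prop) (fun n => ?_) (.of_forall fun r => (hexp r).summable) ?_
    (.of_forall fun r => ?_)
  · filter_upwards [ae_restrict_mem measurableSet_Ioi] with r hr
    have hr' : (0 : ℝ) < r := hr
    rw [norm_mul, Complex.norm_real, Real.norm_of_nonneg (by positivity), norm_mul, norm_div,
      norm_pow, norm_mul, Complex.norm_natCast, Complex.norm_real, Complex.norm_two, ← mul_assoc]
    refine (mul_le_mul_of_nonneg_left (abs_integral_cos_pow_le (n + m)) (by positivity)).trans
      (le_of_eq ?_)
    ring
  · simp_rw [fun r => (hexp r).tsum_eq]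
    exact (integrableOn_exp_neg_sq_mul_pow_mul_exp a (2 * ‖z‖)).mul_const _
  · refine ((hasSum_integral_exp_mul_cos_pow m (2 * r * z)).mul_left _).congr_fun ?_
    intro n
    push_cast
    ring

theorem hasSum_even_integral_exp_neg_sq_mul_exp_cos (j : ℕ) (z : ℂ) :
    HasSum (fun p : ℕ => (((2 : ℝ) ^ (2 * p + 1) / (Nat.factorial (2 * p) : ℝ) *
        Real.Gamma ((p : ℝ) + 3 / 2) * Wallis (2 * p + 2 * j) : ℝ) : ℂ) * z ^ (2 * p))
      (∫ r in Set.Ioi (0 : ℝ), Complex.exp (-(r : ℂ) ^ 2) * (r : ℂ) ^ 2 *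
        ∫ θ in (0 : ℝ)..(2 * Real.pi),
          Complex.exp (2 * (r : ℂ) * z * (Real.cos θ : ℂ)) * (Real.cos θ : ℂ) ^ (2 * j)) := by
  have h := hasSum_integral_exp_neg_sq_mul_exp_cos 2 (2 * j) z
  rw [← Function.Injective.hasSum_iff (g := fun p : ℕ => 2 * p)
    (mul_right_injective₀ two_ne_zero)] at h
  · refine h.congr_fun fun p => ?_
    have hG : (((2 * p + 2 : ℕ) : ℝ) + 1) / 2 = p + 3 / 2 := by push_cast; ring
    have hs : (-1 : ℝ) ^ (2 * p + 2 * j) = 1 := Even.neg_one_pow ⟨p + j, by ring⟩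
    rw [Function.comp_apply, hG, hs]
    push_cast
    ring
  · intro n hn
    have hodd : Odd n := Nat.not_even_iff_odd.mp fun ⟨p, hp⟩ => hn ⟨p, by simp only; omega⟩
    rw [(hodd.add_even (even_two_mul j)).neg_one_pow]
    simp

theorem hasSum_odd_integral_exp_neg_sq_mul_exp_cos (j : ℕ) (z : ℂ) :
    HasSum (fun p : ℕ => (((2 : ℝ) ^ (2 * p + 2) / (Nat.factorial (2 * p + 1) : ℝ) *
        Real.Gamma ((p : ℝ) + 3 / 2) * Wallis (2 * p + (2 * j + 2)) : ℝ) : ℂ) * z ^ (2 * p + 1))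
      (∫ r in Set.Ioi (0 : ℝ), Complex.exp (-(r : ℂ) ^ 2) * (r : ℂ) *
        ∫ θ in (0 : ℝ)..(2 * Real.pi),
          Complex.exp (2 * (r : ℂ) * z * (Real.cos θ : ℂ)) * (Real.cos θ : ℂ) ^ (2 * j + 1)) := by
  have h := hasSum_integral_exp_neg_sq_mul_exp_cos 1 (2 * j + 1) z
  simp_rw [pow_one] at h
  rw [← Function.Injective.hasSum_iff (g := fun p : ℕ => 2 * p + 1)
    ((add_left_injective 1).comp (mul_right_injective₀ two_ne_zero))] at h
  · refine h.congr_fun fun p => ?_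
    have hG : (((2 * p + 1 + 1 : ℕ) : ℝ) + 1) / 2 = p + 3 / 2 := by push_cast; ring
    have hk : 2 * p + 1 + (2 * j + 1) = 2 * p + (2 * j + 2) := by ring
    have hs : (-1 : ℝ) ^ (2 * p + (2 * j + 2)) = 1 := Even.neg_one_pow ⟨p + j + 1, by ring⟩
    rw [Function.comp_apply, hG, hk, hs]
    push_cast
    ring
  · intro n hn
    have heven : Even n := Nat.not_odd_iff_even.mp fun ⟨p, hp⟩ => hn ⟨p, hp.symm⟩
    rw [(heven.add_odd (odd_two_mul_add_one j)).neg_one_pow]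
    simp

/-- Power series expansions of `M₆,…,M₁₀` in terms of the Gamma function and the Wallis
integrals, all series having infinite radius of convergence. -/
theorem stmt12 :
    (∀ z : ℂ, Summable (fun p : ℕ =>
        (((2 : ℝ) ^ (2 * p + 1) / (Nat.factorial (2 * p) : ℝ) *
            Real.Gamma ((p : ℝ) + 3 / 2) * Wallis (2 * p) : ℝ) : ℂ) * z ^ (2 * p))) ∧
    (∀ z : ℂ, M6 z = ∑' p : ℕ,
        (((2 : ℝ) ^ (2 * p + 1) / (Nat.factorial (2 * p) : ℝ) *
            Real.Gamma ((p : ℝ) + 3 / 2) * Wallis (2 * p) : ℝ) : ℂ) * z ^ (2 * p)) ∧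
    (∀ z : ℂ, Summable (fun p : ℕ =>
        (((2 : ℝ) ^ (2 * p + 1) / (Nat.factorial (2 * p) : ℝ) *
            Real.Gamma ((p : ℝ) + 3 / 2) * Wallis (2 * p + 2) : ℝ) : ℂ) * z ^ (2 * p))) ∧
    (∀ z : ℂ, M7 z = ∑' p : ℕ,
        (((2 : ℝ) ^ (2 * p + 1) / (Nat.factorial (2 * p) : ℝ) *
            Real.Gamma ((p : ℝ) + 3 / 2) * Wallis (2 * p + 2) : ℝ) : ℂ) * z ^ (2 * p)) ∧
    (∀ z : ℂ, Summable (fun p : ℕ =>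
        (((2 : ℝ) ^ (2 * p + 1) / (Nat.factorial (2 * p) : ℝ) *
            Real.Gamma ((p : ℝ) + 3 / 2) * Wallis (2 * p + 4) : ℝ) : ℂ) * z ^ (2 * p))) ∧
    (∀ z : ℂ, M8 z = ∑' p : ℕ,
        (((2 : ℝ) ^ (2 * p + 1) / (Nat.factorial (2 * p) : ℝ) *
            Real.Gamma ((p : ℝ) + 3 / 2) * Wallis (2 * p + 4) : ℝ) : ℂ) * z ^ (2 * p)) ∧
    (∀ z : ℂ, Summable (fun p : ℕ =>
        (((2 : ℝ) ^ (2 * p + 2) / (Nat.factorial (2 * p + 1) : ℝ) *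
            Real.Gamma ((p : ℝ) + 3 / 2) * Wallis (2 * p + 2) : ℝ) : ℂ) * z ^ (2 * p + 1))) ∧
    (∀ z : ℂ, M9 z = ∑' p : ℕ,
        (((2 : ℝ) ^ (2 * p + 2) / (Nat.factorial (2 * p + 1) : ℝ) *
            Real.Gamma ((p : ℝ) + 3 / 2) * Wallis (2 * p + 2) : ℝ) : ℂ) * z ^ (2 * p + 1)) ∧
    (∀ z : ℂ, Summable (fun p : ℕ =>
        (((2 : ℝ) ^ (2 * p + 2) / (Nat.factorial (2 * p + 1) : ℝ) *
            Real.Gamma ((p : ℝ) + 3 / 2) * Wallis (2 * p + 4) : ℝ) : ℂ) * z ^ (2 * p + 1))) ∧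
    (∀ z : ℂ, M10 z = ∑' p : ℕ,
        (((2 : ℝ) ^ (2 * p + 2) / (Nat.factorial (2 * p + 1) : ℝ) *
            Real.Gamma ((p : ℝ) + 3 / 2) * Wallis (2 * p + 4) : ℝ) : ℂ) * z ^ (2 * p + 1)) := by
  have h6 (z : ℂ) := hasSum_even_integral_exp_neg_sq_mul_exp_cos 0 z
  have h7 := hasSum_even_integral_exp_neg_sq_mul_exp_cos 1
  have h8 := hasSum_even_integral_exp_neg_sq_mul_exp_cos 2
  have h9 (z : ℂ) := hasSum_odd_integral_exp_neg_sq_mul_exp_cos 0 z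
  have h10 := hasSum_odd_integral_exp_neg_sq_mul_exp_cos 1
  simp only [mul_zero, add_zero, pow_zero, mul_one] at h6
  simp only [mul_zero, zero_add, pow_one] at h9
  exact ⟨fun z => (h6 z).summable, fun z => (h6 z).tsum_eq.symm,
    fun z => (h7 z).summable, fun z => (h7 z).tsum_eq.symm,
    fun z => (h8 z).summable, fun z => (h8 z).tsum_eq.symm,
    fun z => (h9 z).summable, fun z => (h9 z).tsum_eq.symm,
    fun z => (h10 z).summable, fun z => (h10 z).tsum_eq.symm⟩
end
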